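/- Let 0 < p ≤ 1/2 and 0 < α < 1, set c := 1 − αp and d₁ := 1 − 2p, and let d₂ ≥ A(α,p). Then for every s > 0: ((1 + d₁·s^c)^{1/(1−c)} + (d₁ + s^c)^{1/(1−c)})^{1−c} ≤ d₂·(1+s)^c. -/

import Mathlib

/-- `‖(a,b)‖_q = (|a|^q + |b|^q)^{1/q}`. -/
noncomputable def pairNorm (q a b : ℝ) : ℝ := (|a| ^ q + |b| ^ q) ^ (1 / q)

/-- `A(α,p) = sup_{0≤x≤1} ‖(1−2px, 1−2p(1−x))‖_{1/(αp)} / ‖(x,1−x)‖_{1/(1−αp)}`. -/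
noncomputable def Aconst (α p : ℝ) : ℝ :=
  sSup ((fun x : ℝ =>
      pairNorm (1 / (α * p)) (1 - 2 * p * x) (1 - 2 * p * (1 - x)) /
        pairNorm (1 / (1 - α * p)) x (1 - x)) '' Set.Icc 0 1)

theorem pairNorm_div_left {q a b t : ℝ} (hq : q ≠ 0) (ht : 0 < t) :
    pairNorm q (a / t) (b / t) = pairNorm q a b / t := by
  have h : 0 ≤ |a| ^ q + |b| ^ q := by positivity
  simp only [pairNorm, abs_div, abs_of_pos ht]
  rw [Real.div_rpow (abs_nonneg a) ht.le, Real.div_rpow (abs_nonneg b) ht.le, ← add_div,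
    Real.div_rpow h (by positivity), ← Real.rpow_mul ht.le, mul_one_div_cancel hq, Real.rpow_one]

theorem pairNorm_pos {q a b : ℝ} (h : a ≠ 0 ∨ b ≠ 0) : 0 < pairNorm q a b := by
  unfold pairNorm
  rcases h with h | h
  · have := Real.rpow_pos_of_pos (abs_pos.2 h) q
    positivity
  · have := Real.rpow_pos_of_pos (abs_pos.2 h) q
    positivity

theorem Continuous.pairNorm {q : ℝ} (hq : 0 ≤ q) {f g : ℝ → ℝ} (hf : Continuous f)
    (hg : Continuous g) : Continuous fun x => pairNorm q (f x) (g x) := by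
  unfold _root_.pairNorm
  exact ((hf.abs.rpow_const fun _ => Or.inr hq).add
    (hg.abs.rpow_const fun _ => Or.inr hq)).rpow_const fun _ => Or.inr (by positivity)

theorem le_Aconst {α p x : ℝ} (h0 : 0 ≤ α * p) (h1 : α * p ≤ 1) (hx : x ∈ Set.Icc (0 : ℝ) 1) :
    pairNorm (1 / (α * p)) (1 - 2 * p * x) (1 - 2 * p * (1 - x)) /
      pairNorm (1 / (1 - α * p)) x (1 - x) ≤ Aconst α p := by
  have h2 : 0 ≤ 1 - α * p := by linarith
  refine le_csSup (isCompact_Icc.bddAbove_image (Continuous.continuousOn ?_)) ⟨x, hx, rfl⟩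
  refine (Continuous.pairNorm (by positivity) (by fun_prop) (by fun_prop)).div
    (Continuous.pairNorm (by positivity) (by fun_prop) (by fun_prop)) fun y => ?_
  refine (pairNorm_pos ?_).ne'
  by_cases hy : y = 0
  · right
    simp [hy]
  · exact Or.inl hy

/-- with `c = 1 − αp`, `d₁ = 1 − 2p` and `d₂ ≥ A(α,p)`, for every `s > 0`:
`((1 + d₁·s^c)^{1/(1−c)} + (d₁ + s^c)^{1/(1−c)})^{1−c} ≤ d₂·(1+s)^c`. -/
theorem stmt13 (p α : ℝ) (hp : 0 < p) (hp2 : p ≤ 1 / 2) (hα : 0 < α) (hα1 : α < 1)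
    (c d₁ d₂ : ℝ) (hc : c = 1 - α * p) (hd₁ : d₁ = 1 - 2 * p) (hd₂ : Aconst α p ≤ d₂)
    (s : ℝ) (hs : 0 < s) :
    ((1 + d₁ * s ^ c) ^ (1 / (1 - c)) + (d₁ + s ^ c) ^ (1 / (1 - c))) ^ (1 - c)
      ≤ d₂ * (1 + s) ^ c := by
  have hap : 0 < α * p := by positivity
  have hap1 : α * p < 1 := by nlinarith
  have hc0 : 0 < c := by linarith
  have hd0 : 0 ≤ d₁ := by linarith
  have h1c : α * p = 1 - c := by linarith
  have hu : 0 < s ^ c := Real.rpow_pos_of_pos hs c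
  have hsu : (s ^ c) ^ (1 / c) = s := by
    rw [← Real.rpow_mul hs.le, mul_one_div_cancel hc0.ne', Real.rpow_one]
  generalize s ^ c = u at hu hsu ⊢
  have ht : 0 < 1 + u := by linarith
  have hx : u / (1 + u) ∈ Set.Icc (0 : ℝ) 1 :=
    ⟨by positivity, (div_le_one ht).2 (by linarith)⟩
  have key := (le_Aconst hap.le hap1.le hx).trans hd₂
  have e₁ : 1 - 2 * p * (u / (1 + u)) = (1 + d₁ * u) / (1 + u) := by
    rw [hd₁]
    field_simp
    ring
  have e₂ : 1 - 2 * p * (1 - u / (1 + u)) = (d₁ + u) / (1 + u) := by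
    rw [hd₁]
    field_simp
    ring
  have e₃ : 1 - u / (1 + u) = 1 / (1 + u) := by
    field_simp
    ring
  rw [e₁, e₂, e₃, ← hc, h1c, pairNorm_div_left (one_div_ne_zero (by linarith)) ht,
    pairNorm_div_left (one_div_ne_zero hc0.ne') ht, div_div_div_cancel_right₀ ht.ne',
    div_le_iff₀ (pairNorm_pos (Or.inl hu.ne'))] at key
  have h₁ : 0 ≤ 1 + d₁ * u := by positivity
  have h₂ : 0 ≤ d₁ + u := by positivity
  simpa only [pairNorm, abs_of_nonneg h₁, abs_of_nonneg h₂, abs_of_pos hu, hsu, abs_one,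
    Real.one_rpow, one_div_one_div, add_comm s 1] using key
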